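/- (Functional incompleteness of binary connectives modulo contractive valuation congruence) Suppose |A| > 2 and let a, b, c ∈ A be pairwise distinct. Then there is no term t ∈ T_C^{1,2}(A) with t =_cr a◁b▷c; hence the ternary conditional operator cannot be expressed modulo contractive valuation congruence by any collection of unary and binary connectives definable with conditional composition. -/

import Mathlib

/-- Propositional statements over atoms `A`: constants `T`, `F`, an atom `a`
for each `a ∈ A`, and the ternary conditional composition
`cond x y z = x ◁ y ▷ z` (with `y` the central condition). -/
inductive PS (A : Type) : Type where
  | tt : PS A
  | ff : PS A
  | atom : A → PS A
  | cond : PS A → PS A → PS A → PS A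

/-- A valuation algebra (VA) over `A`. -/
structure VA (A : Type) where
  Val : Type
  Tv : Val
  Fv : Val
  yd : A → Val → Bool
  dv : A → Val → Val
  yd_T : ∀ a, yd a Tv = true
  yd_F : ∀ a, yd a Fv = false
  dv_T : ∀ a, dv a Tv = Tv
  dv_F : ∀ a, dv a Fv = Fv

variable {A : Type}

mutual
  /-- Evaluation `P/H` of a propositional statement over a valuation `H`. -/
  def PS.eval (V : VA A) : PS A → V.Val → Bool
    | .tt, _ => true
    | .ff, _ => false
    | .atom a, H => V.yd a H
    | .cond p q r, H =>
        if PS.eval V q H then PS.eval V p (PS.deriv V q H)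
        else PS.eval V r (PS.deriv V q H)
  /-- The generalized derivative `∂_P(H)`. -/
  def PS.deriv (V : VA A) : PS A → V.Val → V.Val
    | .tt, H => H
    | .ff, H => H
    | .atom a, H => V.dv a H
    | .cond p q r, H =>
        if PS.eval V q H then PS.deriv V p (PS.deriv V q H)
        else PS.deriv V r (PS.deriv V q H)
end

/-- `K`-equivalence: equal evaluation results in all members of the class `K`. -/
def KEquiv (K : VA A → Prop) (P Q : PS A) : Prop :=
  ∀ V : VA A, K V → ∀ H : V.Val, PS.eval V P H = PS.eval V Q H

/-- A congruence with respect to conditional composition. -/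
def IsCondCongruence (R : PS A → PS A → Prop) : Prop :=
  Equivalence R ∧
    ∀ ⦃x x' y y' z z' : PS A⦄, R x x' → R y y' → R z z' →
      R (PS.cond x y z) (PS.cond x' y' z')

/-- `K`-congruence: the largest congruence contained in `K`-equivalence. -/
def KCong (K : VA A → Prop) (P Q : PS A) : Prop :=
  ∃ R : PS A → PS A → Prop,
    IsCondCongruence R ∧ (∀ x y, R x y → KEquiv K x y) ∧ R P Q

/-- Derivability (of closed equations) in equational logic from the axioms `CP`
together with an additional set `Ax` of equational axioms. -/
inductive Deriv (Ax : PS A → PS A → Prop) : PS A → PS A → Prop where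
  | ax {p q} : Ax p q → Deriv Ax p q
  | cp1 (x y) : Deriv Ax (.cond x .tt y) x
  | cp2 (x y) : Deriv Ax (.cond x .ff y) y
  | cp3 (x) : Deriv Ax (.cond .tt x .ff) x
  | cp4 (x y z u v) :
      Deriv Ax (.cond x (.cond y z u) v)
               (.cond (.cond x y v) z (.cond x u v))
  | refl (x) : Deriv Ax x x
  | symm {p q} : Deriv Ax p q → Deriv Ax q p
  | trans {p q r} : Deriv Ax p q → Deriv Ax q r → Deriv Ax p r
  | congr {x x' y y' z z'} : Deriv Ax x x' → Deriv Ax y y' → Deriv Ax z z' →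
      Deriv Ax (.cond x y z) (.cond x' y' z')

/-- No additional axioms: plain `CP`. -/
def NoAx : PS A → PS A → Prop := fun _ _ => False

/-- The class `fr` of free valuation algebras: all VAs. -/
def frK : VA A → Prop := fun _ => True

/-- The class `rp` of repetition-proof VAs. -/
def rpK (V : VA A) : Prop :=
  ∀ (a : A) (x : V.Val), V.yd a x = V.yd a (V.dv a x)

/-- The class `cr` of contractive VAs. -/
def crK (V : VA A) : Prop :=
  rpK V ∧ ∀ (a : A) (x : V.Val), V.dv a (V.dv a x) = V.dv a x

/-- The class `wm` of weakly memorizing VAs. -/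
def wmK (V : VA A) : Prop :=
  crK V ∧ ∀ (a b : A) (x : V.Val),
    V.yd b (V.dv a x) = V.yd a x →
      V.dv a (V.dv b (V.dv a x)) = V.dv b (V.dv a x) ∧
      V.yd a (V.dv b (V.dv a x)) = V.yd a x

/-- The class `mem` of memorizing VAs. -/
def memK (V : VA A) : Prop :=
  crK V ∧ ∀ (a b : A) (x : V.Val),
    V.dv a (V.dv b (V.dv a x)) = V.dv b (V.dv a x) ∧
    V.yd a (V.dv b (V.dv a x)) = V.yd a x

/-- The class `st` of static VAs. -/
def stK (V : VA A) : Prop :=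
  ∀ (a b : A) (x : V.Val), V.yd a (V.dv b x) = V.yd a x

/-- Substitution of terms for variables (atoms). -/
def PS.substVar {X Y : Type} (σ : X → PS Y) : PS X → PS Y
  | .tt => .tt
  | .ff => .ff
  | .atom x => σ x
  | .cond p q r => .cond (p.substVar σ) (q.substVar σ) (r.substVar σ)

/-- `T_C^{1,2}(X)`: the smallest set of terms over variables `X` containing
`T` and `F`, all terms of `T_C({x})` for `x ∈ X` (coded as terms over the
one-element variable set `Unit`), all terms of `T_C({x,y})` for `x, y ∈ X`
(coded as terms over the two-element variable set `Bool`), and closed under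
substitution. -/
inductive T12 {X : Type} : PS X → Prop where
  | tt : T12 .tt
  | ff : T12 .ff
  | one (x : X) (t : PS Unit) : T12 (t.substVar fun _ => .atom x)
  | two (x y : X) (t : PS Bool) :
      T12 (t.substVar fun b => if b then .atom x else .atom y)
  | subst {t : PS X} (σ : X → PS X) : T12 t → (∀ x, T12 (σ x)) →
      T12 (t.substVar σ)

/-- `T_C^{1,2}(A)`: the closed terms obtained by substituting constants from
`A` for the variables in terms of `T_C^{1,2}(X)` (with `X = ℕ` a countable
set of variables). -/
def TC12A {A : Type} (t : PS A) : Prop :=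
  ∃ (s : PS ℕ) (f : ℕ → A), T12 s ∧ t = s.substVar (fun n => .atom (f n))

theorem PS.substVar_substVar {X Y W : Type} (σ : X → PS Y) (τ : Y → PS W) (t : PS X) :
    (t.substVar σ).substVar τ = t.substVar fun x => (σ x).substVar τ := by
  induction t with
  | tt => rfl
  | ff => rfl
  | atom x => rfl
  | cond p q r hp hq hr => simp [PS.substVar, hp, hq, hr]

/-- A statement whose evaluation has a fixed result and no effect. -/
def PS.IsConst (t : PS A) : Prop :=
  ∃ p, ∀ (V : VA A) (H : V.Val), t.eval V H = p ∧ t.deriv V H = H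

/-- In contractive valuation algebras, evaluating `t` starts by evaluating the atom `x`. -/
def PS.HasHead (x : A) (t : PS A) : Prop :=
  ∀ (V : VA A), crK V → ∀ H : V.Val,
    t.eval V (V.dv x H) = t.eval V H ∧ t.deriv V (V.dv x H) = t.deriv V H

theorem PS.isConst_or_hasHead (t : PS A) : t.IsConst ∨ ∃ x, t.HasHead x := by
  induction t with
  | tt => exact .inl ⟨true, fun V H => by simp [PS.eval, PS.deriv]⟩
  | ff => exact .inl ⟨false, fun V H => by simp [PS.eval, PS.deriv]⟩
  | atom x =>
    refine .inr ⟨x, fun V hV H => ?_⟩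
    simp only [PS.eval, PS.deriv]
    exact ⟨(hV.1 x H).symm, hV.2 x H⟩
  | cond p q r hp hq hr =>
    obtain ⟨k, hk⟩ | ⟨x, hx⟩ := hq
    · cases k
      · refine hr.imp (fun ⟨m, hm⟩ => ⟨m, fun V H => ?_⟩) (fun ⟨x, hx⟩ => ⟨x, fun V hV H => ?_⟩)
        · simpa [PS.eval, PS.deriv, hk] using hm V H
        · simpa [PS.eval, PS.deriv, hk] using hx V hV H
      · refine hp.imp (fun ⟨m, hm⟩ => ⟨m, fun V H => ?_⟩) (fun ⟨x, hx⟩ => ⟨x, fun V hV H => ?_⟩)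
        · simpa [PS.eval, PS.deriv, hk] using hm V H
        · simpa [PS.eval, PS.deriv, hk] using hx V hV H
    · refine .inr ⟨x, fun V hV H => ?_⟩
      obtain ⟨h1, h2⟩ := hx V hV H
      simp [PS.eval, PS.deriv, h1, h2]

namespace Incompleteness

/-- States of the test algebras: nothing evaluated, the condition evaluated, a branch
evaluated, and the two constant valuations. -/
inductive St : Type where
  | s0 | s1 | s2 | sT | sF

/-- The constant valuation entered after an atom evaluated out of order. -/
def dead : Bool → St
  | true => .sF
  | false => .sT

open Classical in
/-- The answers in the test algebra. -/
noncomputable def answer (b : A) (e : Bool → A) (v w : Bool) (x : A) : St → Bool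
  | .s0 => if x = b then v else !w
  | .s1 => if x = b then v else if x = e v then w else !w
  | .s2 => if x = e v then w else !w
  | .sT => true
  | .sF => false

open Classical in
/-- The transitions of the test algebra. -/
noncomputable def next (b : A) (e : Bool → A) (v w : Bool) (x : A) : St → St
  | .s0 => if x = b then .s1 else dead w
  | .s1 => if x = b then .s1 else if x = e v then .s2 else dead w
  | .s2 => if x = e v then .s2 else dead w
  | .sT => .sT
  | .sF => .sF

/-- The valuation algebra in which `b` is answered by `v` and then `e v` by `w`, while any
other order of evaluation leads to the constant valuation with answer `!w`. -/
noncomputable def testVA (b : A) (e : Bool → A) (v w : Bool) : VA A where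
  Val := St
  Tv := .sT
  Fv := .sF
  yd := answer b e v w
  dv := next b e v w
  yd_T _ := rfl
  yd_F _ := rfl
  dv_T _ := rfl
  dv_F _ := rfl

variable {b : A} {e : Bool → A}

theorem crK_testVA (hb : ∀ u, e u ≠ b) (v w : Bool) : crK (testVA b e v w) := by
  have hv := hb v
  constructor <;> intro x s <;>
  · simp only [testVA]
    rcases s with _ | _ | _ | _ | _ <;> cases w <;> by_cases h1 : x = b <;>
      by_cases h2 : x = e v <;> simp_all [answer, next, dead]

/-- Evaluation in the test algebra. -/
noncomputable def ev (b : A) (e : Bool → A) (v w : Bool) (t : PS A) (s : St) : Bool :=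
  t.eval (testVA b e v w) s

/-- Derivative in the test algebra. -/
noncomputable def dr (b : A) (e : Bool → A) (v w : Bool) (t : PS A) (s : St) : St :=
  t.deriv (testVA b e v w) s

section runs

variable {v w : Bool} {s : St} {t p q r : PS A} {x : A}

theorem ev_tt : ev b e v w .tt s = true := by simp [ev, PS.eval]
theorem ev_ff : ev b e v w .ff s = false := by simp [ev, PS.eval]
theorem ev_atom : ev b e v w (.atom x) s = answer b e v w x s := by simp [ev, PS.eval, testVA]
theorem ev_cond : ev b e v w (.cond p q r) s =
    if ev b e v w q s then ev b e v w p (dr b e v w q s)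
    else ev b e v w r (dr b e v w q s) := by
  simp only [ev, dr, PS.eval]
  rfl
theorem dr_tt : dr b e v w .tt s = s := by simp [dr, PS.deriv]
theorem dr_ff : dr b e v w .ff s = s := by simp [dr, PS.deriv]
theorem dr_atom : dr b e v w (.atom x) s = next b e v w x s := by simp [dr, PS.deriv, testVA]
theorem dr_cond : dr b e v w (.cond p q r) s =
    if ev b e v w q s then dr b e v w p (dr b e v w q s)
    else dr b e v w r (dr b e v w q s) := by
  simp only [ev, dr, PS.deriv]
  rfl

theorem dr_dead (t : PS A) : dr b e v w t (dead w) = dead w := by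
  induction t with
  | tt => exact dr_tt
  | ff => exact dr_ff
  | atom x => cases w <;> simp [dr_atom, next, dead]
  | cond p q r hp hq hr => rw [dr_cond, hq, hp, hr, ite_self]

theorem _root_.PS.HasHead.run (hb : ∀ u, e u ≠ b) (h : t.HasHead x) (v w : Bool) (s : St) :
    ev b e v w t (next b e v w x s) = ev b e v w t s ∧
      dr b e v w t (next b e v w x s) = dr b e v w t s :=
  h (testVA b e v w) (crK_testVA hb v w) s

theorem dr_of_next_dead (hb : ∀ u, e u ≠ b) (h : t.HasHead x)
    (hn : next b e v w x s = dead w) : dr b e v w t s = dead w := by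
  rw [← (h.run hb v w s).2, hn, dr_dead]

/-- A branch has been evaluated, or the order of evaluation has been violated. -/
def Late (w : Bool) (s : St) : Prop := s = .s2 ∨ s = dead w

theorem Late.dr (t : PS A) (h : Late w s) : Late w (dr b e v w t s) := by
  induction t generalizing s with
  | tt => rwa [dr_tt]
  | ff => rwa [dr_ff]
  | atom x =>
    rcases h with rfl | rfl
    · rw [dr_atom, next]
      split
      · exact .inl rfl
      · exact .inr rfl
    · exact .inr (dr_dead _)
  | cond p q r hp hq hr =>
    rw [dr_cond]
    split
    · exact hp (hq h)
    · exact hr (hq h)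

theorem stay_or_late (v : Bool) (t : PS A) :
    (∃ k, ∀ w, ev b e v w t .s1 = k ∧ dr b e v w t .s1 = .s1) ∨
      ∀ w, Late w (dr b e v w t .s1) := by
  induction t with
  | tt => exact .inl ⟨true, fun w => ⟨ev_tt, dr_tt⟩⟩
  | ff => exact .inl ⟨false, fun w => ⟨ev_ff, dr_ff⟩⟩
  | atom x =>
    by_cases h : x = b
    · exact .inl ⟨v, fun w => by simp [ev_atom, dr_atom, answer, next, h]⟩
    · refine .inr fun w => ?_
      by_cases h' : x = e v
      · exact .inl (by simp only [dr_atom, next, if_neg h, if_pos h'])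
      · exact .inr (by simp only [dr_atom, next, if_neg h, if_neg h'])
  | cond p q r hp hq hr =>
    obtain ⟨k, hk⟩ | hq := hq
    · simp only [ev_cond, dr_cond, hk]
      cases k
      · exact hr
      · exact hp
    · refine .inr fun w => ?_
      rw [dr_cond]
      split <;> exact (hq w).dr _

end runs

/-- A set of configurations: the two answers of the test algebra and the current state. -/
abbrev Cfgs := Set (Bool × Bool × St)

/-- The configurations reached from `G` by evaluating `t` with result `k`. -/
def after (b : A) (e : Bool → A) (t : PS A) (k : Bool) (G : Cfgs) : Cfgs :=
  {g | ∃ s, (g.1, g.2.1, s) ∈ G ∧ ev b e g.1 g.2.1 t s = k ∧ dr b e g.1 g.2.1 t s = g.2.2}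

theorem mem_after {t : PS A} {G : Cfgs} {v w k : Bool} {s s' : St} (h : (v, w, s) ∈ G)
    (h1 : ev b e v w t s = k) (h2 : dr b e v w t s = s') : (v, w, s') ∈ after b e t k G :=
  ⟨s, h, h1, h2⟩

/-- Every configuration has evaluated a branch, whose answer is determined by the condition. -/
def Won (G : Cfgs) : Prop :=
  ∀ v w s, (v, w, s) ∈ G → s = .s2 ∧ ∀ s', (v, !w, s') ∉ G

/-- No composition of the statements `Z i` turns `G` into winning sets for both results. -/
def Bad (b : A) (e : Bool → A) (Z : Bool → PS A) (G : Cfgs) : Prop :=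
  ∃ C : Set Cfgs, (∀ G ∈ C, ∀ G', G ⊆ G' → G' ∈ C) ∧ (∀ G ∈ C, ¬ Won G) ∧
    (∀ G ∈ C, ∀ i, ∃ k, after b e (Z i) k G ∈ C) ∧ G ∈ C

section bad

variable {Z : Bool → PS A} {G : Cfgs}

theorem Bad.mono {G' : Cfgs} (h : Bad b e Z G) (hG : G ⊆ G') : Bad b e Z G' := by
  obtain ⟨C, h1, h2, h3, h4⟩ := h
  exact ⟨C, h1, h2, h3, h1 _ h4 _ hG⟩

theorem Bad.not_won (h : Bad b e Z G) : ¬ Won G := by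
  obtain ⟨C, h1, h2, h3, h4⟩ := h
  exact h2 _ h4

theorem Bad.step (h : Bad b e Z G) (i : Bool) : ∃ k, Bad b e Z (after b e (Z i) k G) := by
  obtain ⟨C, h1, h2, h3, h4⟩ := h
  obtain ⟨k, hk⟩ := h3 _ h4 i
  exact ⟨k, C, h1, h2, h3, hk⟩

theorem Bad.coinduct (C : Cfgs → Prop) (hup : ∀ G, C G → ∀ G', G ⊆ G' → C G')
    (hw : ∀ G, C G → ¬ Won G)
    (hs : ∀ G, C G → ∀ i, ∃ k, C (after b e (Z i) k G) ∨ Bad b e Z (after b e (Z i) k G))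
    (hG : C G) : Bad b e Z G := by
  refine ⟨{G | C G ∨ Bad b e Z G}, ?_, ?_, ?_, .inl hG⟩
  · rintro G (h | h) G' hG'
    · exact .inl (hup G h G' hG')
    · exact .inr (h.mono hG')
  · rintro G (h | h)
    · exact hw G h
    · exact h.not_won
  · rintro G (h | h) i
    · exact hs G h i
    · exact (h.step i).imp fun _ => .inr

theorem Bad.after_subst (f : PS Bool) (h : Bad b e Z G) :
    ∃ k, Bad b e Z (after b e (f.substVar Z) k G) := by
  induction f generalizing G with
  | tt => exact ⟨true, h.mono fun g hg => mem_after hg ev_tt dr_tt⟩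
  | ff => exact ⟨false, h.mono fun g hg => mem_after hg ev_ff dr_ff⟩
  | atom i => exact h.step i
  | cond p q r hp hq hr =>
    obtain ⟨k, hk⟩ := hq h
    cases k
    · obtain ⟨m, hm⟩ := hr hk
      refine ⟨m, hm.mono ?_⟩
      rintro ⟨v, w, s⟩ ⟨s', ⟨s'', h1, h2, h3⟩, h4, h5⟩
      dsimp only at *
      exact mem_after h1 (by simp [PS.substVar, ev_cond, h2, h3, h4])
        (by simp [PS.substVar, dr_cond, h2, h3, h5])
    · obtain ⟨m, hm⟩ := hp hk
      refine ⟨m, hm.mono ?_⟩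
      rintro ⟨v, w, s⟩ ⟨s', ⟨s'', h1, h2, h3⟩, h4, h5⟩
      dsimp only at *
      exact mem_after h1 (by simp [PS.substVar, ev_cond, h2, h3, h4])
        (by simp [PS.substVar, dr_cond, h2, h3, h5])

theorem bad_of_dead {v w : Bool} (h : (v, w, dead w) ∈ G) : Bad b e Z G := by
  refine Bad.coinduct (fun G => (v, w, dead w) ∈ G) (fun G h G' hG => hG h) ?_ ?_ h
  · intro G h hW
    have := (hW v w _ h).1
    cases w <;> simp [dead] at this
  · intro G h i
    exact ⟨_, .inl (mem_after h rfl (dr_dead _))⟩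

theorem bad_after_of_dead {t : PS A} {v w : Bool} {s : St} (h : (v, w, s) ∈ G)
    (hd : dr b e v w t s = dead w) : ∃ k, Bad b e Z (after b e t k G) :=
  ⟨_, bad_of_dead (mem_after h rfl hd)⟩

theorem after_const {t : PS A} {k : Bool}
    (hk : ∀ (V : VA A) (H : V.Val), t.eval V H = k ∧ t.deriv V H = H) :
    G ⊆ after b e t k G :=
  fun g hg => mem_after hg (hk (testVA b e g.1 g.2.1) g.2.2).1 (hk (testVA b e g.1 g.2.1) g.2.2).2

theorem next_s2 {v w : Bool} {x : A} (h : x ≠ e v) : next b e v w x .s2 = dead w := by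
  simp [next, h]

theorem next_s1 {v w : Bool} {x : A} (h : x ≠ b) (h' : x ≠ e v) :
    next b e v w x .s1 = dead w := by
  simp [next, h, h']

theorem bad_of_s2_s1 (hb : ∀ u, e u ≠ b) (he : ∀ u, e u ≠ e !u) {u w w' : Bool}
    (h : (u, w, St.s2) ∈ G) (h' : (!u, w', St.s1) ∈ G) : Bad b e Z G := by
  refine Bad.coinduct (fun G => (u, w, St.s2) ∈ G ∧ (!u, w', St.s1) ∈ G)
    (fun G h G' hG => ⟨hG h.1, hG h.2⟩) ?_ ?_ ⟨h, h'⟩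
  · intro G h hW
    simpa using (hW _ _ _ h.2).1
  · intro G h i
    obtain ⟨k, hk⟩ | ⟨x, hx⟩ := (Z i).isConst_or_hasHead
    · exact ⟨k, .inl ⟨after_const hk h.1, after_const hk h.2⟩⟩
    · by_cases hxu : x = e u
      · subst hxu
        exact (bad_after_of_dead h.2
          (dr_of_next_dead hb hx (next_s1 (hb u) (he u)))).imp fun _ => .inr
      · exact (bad_after_of_dead h.1 (dr_of_next_dead hb hx (next_s2 hxu))).imp fun _ => .inr

theorem bad_of_three_s2 (hb : ∀ u, e u ≠ b) (he : ∀ u, e u ≠ e !u) {u w : Bool}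
    (h : ∀ w, (u, w, St.s2) ∈ G) (h' : (!u, w, St.s2) ∈ G) : Bad b e Z G := by
  refine Bad.coinduct (fun G => (∀ w, (u, w, St.s2) ∈ G) ∧ (!u, w, St.s2) ∈ G)
    (fun G h G' hG => ⟨fun w => hG (h.1 w), hG h.2⟩) ?_ ?_ ⟨h, h'⟩
  · intro G h hW
    exact (hW _ _ _ (h.1 true)).2 _ (h.1 _)
  · intro G h i
    obtain ⟨k, hk⟩ | ⟨x, hx⟩ := (Z i).isConst_or_hasHead
    · exact ⟨k, .inl ⟨fun w => after_const hk (h.1 w), after_const hk h.2⟩⟩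
    · by_cases hxu : x = e u
      · subst hxu
        exact (bad_after_of_dead h.2 (dr_of_next_dead hb hx (next_s2 (he u)))).imp fun _ => .inr
      · exact (bad_after_of_dead (h.1 true)
          (dr_of_next_dead hb hx (next_s2 hxu))).imp fun _ => .inr

/-- `t` does not start by evaluating `x`. -/
def Avoids (x : A) (t : PS A) : Prop := t.IsConst ∨ ∃ y, y ≠ x ∧ t.HasHead y

theorem avoids_or_hasHead (x : A) (t : PS A) : Avoids x t ∨ t.HasHead x := by
  obtain h | ⟨y, hy⟩ := t.isConst_or_hasHead
  · exact .inl (.inl h)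
  · by_cases hxy : y = x
    · exact .inr (hxy ▸ hy)
    · exact .inl (.inr ⟨y, hxy, hy⟩)

theorem bad_of_two_s2 (hb : ∀ u, e u ≠ b) {u : Bool} (hZ : ∀ i, Avoids (e u) (Z i))
    (h : ∀ w, (u, w, St.s2) ∈ G) : Bad b e Z G := by
  refine Bad.coinduct (fun G => ∀ w, (u, w, St.s2) ∈ G)
    (fun G h G' hG w => hG (h w)) ?_ ?_ h
  · intro G h hW
    exact (hW _ _ _ (h true)).2 _ (h _)
  · intro G h i
    obtain ⟨k, hk⟩ | ⟨x, hxu, hx⟩ := hZ i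
    · exact ⟨k, .inl fun w => after_const hk (h w)⟩
    · exact (bad_after_of_dead (h true)
        (dr_of_next_dead hb hx (next_s2 hxu))).imp fun _ => .inr

/-- Evaluating `t` in `s1` reveals nothing about the answer of `e u`. -/
def Stays (b : A) (e : Bool → A) (u : Bool) (t : PS A) : Prop :=
  ∃ k, ∀ w, ev b e u w t .s1 = k ∧ dr b e u w t .s1 = .s1

theorem bad_of_two_s1 {u : Bool}
    (hZ : ∀ i, Stays b e u (Z i) ∨ (∃ w, dr b e u w (Z i) .s1 = dead w) ∨
      ((∀ j, Avoids (e u) (Z j)) ∧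
        ∃ k, ∀ w, ev b e u w (Z i) .s1 = k ∧ dr b e u w (Z i) .s1 = .s2))
    (hb : ∀ u, e u ≠ b) (h : ∀ w, (u, w, St.s1) ∈ G) : Bad b e Z G := by
  refine Bad.coinduct (fun G => ∀ w, (u, w, St.s1) ∈ G)
    (fun G h G' hG w => hG (h w)) ?_ ?_ h
  · intro G h hW
    exact (hW _ _ _ (h true)).2 _ (h _)
  · intro G h i
    obtain ⟨k, hk⟩ | ⟨w, hw⟩ | ⟨hj, k, hk⟩ := hZ i
    · exact ⟨k, .inl fun w => mem_after (h w) (hk w).1 (hk w).2⟩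
    · exact (bad_after_of_dead (h w) hw).imp fun _ => .inr
    · exact ⟨k, .inr (bad_of_two_s2 hb hj fun w => mem_after (h w) (hk w).1 (hk w).2)⟩

end bad

/-- `t` behaves like `a ◁ b ▷ c` up to negation of the two branches. -/
def Branches (b : A) (e : Bool → A) (t : PS A) : Prop :=
  ∀ v, (∀ w, dr b e v w t .s0 = .s2) ∧ ev b e v true t .s0 ≠ ev b e v false t .s0

theorem stays_of_isConst {t : PS A} (h : t.IsConst) (u : Bool) : Stays b e u t := by
  obtain ⟨k, hk⟩ := h
  exact ⟨k, fun w => hk (testVA b e u w) .s1⟩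

theorem exists_dead_or_eq_s2 {t : PS A} {u : Bool} (h : ¬ Stays b e u t) :
    (∃ w, dr b e u w t .s1 = dead w) ∨ ∀ w, dr b e u w t .s1 = .s2 := by
  by_contra! hc
  have := (stay_or_late u t).resolve_left h
  obtain ⟨w, hw⟩ := hc.2
  exact (this w).elim hw (hc.1 w)

theorem hasHead_s0 (hb : ∀ u, e u ≠ b) {t : PS A} (h : t.HasHead b) (v w : Bool) :
    ev b e v w t .s0 = ev b e v w t .s1 ∧ dr b e v w t .s0 = dr b e v w t .s1 := by
  have := h.run hb v w .s0
  simp only [next, if_true] at this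
  exact ⟨this.1.symm, this.2.symm⟩

theorem exists_unseparated (hb : ∀ u, e u ≠ b) {t : PS A} (h : t.HasHead b)
    (hs : ∀ u, ∀ w, dr b e u w t .s1 = .s2) (ht : ¬ Branches b e t) :
    ∃ u k, ∀ w, ev b e u w t .s1 = k := by
  by_contra! hc
  refine ht fun v => ⟨fun w => by rw [(hasHead_s0 hb h v w).2, hs], fun heq => ?_⟩
  rw [(hasHead_s0 hb h _ _).1, (hasHead_s0 hb h _ _).1] at heq
  obtain ⟨w, hw⟩ := hc v (ev b e v true t .s1)
  cases w
  · exact hw heq.symm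
  · exact hw rfl

theorem exists_ne_branch (he : ∀ u, e u ≠ e !u) (x : A) : ∃ u, x ≠ e u := by
  by_cases h : x = e true
  · exact ⟨false, h ▸ he true⟩
  · exact ⟨true, h⟩

section main

variable {Z : Bool → PS A}

theorem forall_avoids {u i : Bool} (h : Avoids (e u) (Z i)) (h' : Avoids (e u) (Z !i)) :
    ∀ j, Avoids (e u) (Z j) := by
  intro j
  cases i <;> cases j <;> assumption

/-- The step at a statement that starts with the condition `b`. -/
theorem exists_after_s1 (hb : ∀ u, e u ≠ b) (he : ∀ u, e u ≠ e !u)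
    (hZ : ∀ i, ¬ Branches b e (Z i)) {G : Cfgs} (h : ∀ v w, (v, w, St.s1) ∈ G) (i : Bool)
    (hi : (Z i).HasHead b) :
    ∃ k, (∀ v w, (v, w, St.s1) ∈ after b e (Z i) k G) ∨ Bad b e Z (after b e (Z i) k G) := by
  have hav : ∀ u, Avoids (e u) (Z i) := fun u => .inr ⟨b, (hb u).symm, hi⟩
  by_cases hdead : ∃ u w, dr b e u w (Z i) .s1 = dead w
  · obtain ⟨u, w, hd⟩ := hdead
    exact (bad_after_of_dead (h u w) hd).imp fun _ => .inr
  have hgo : ∀ u, ¬ Stays b e u (Z i) → ∀ w, dr b e u w (Z i) .s1 = .s2 := fun u hu =>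
    (exists_dead_or_eq_s2 hu).resolve_left fun ⟨w, hw⟩ => hdead ⟨u, w, hw⟩
  by_cases hall : ∀ u, ¬ Stays b e u (Z i)
  · obtain ⟨u, k, hk⟩ := exists_unseparated hb hi (fun u => hgo u (hall u)) (hZ i)
    have hu : ∀ w, (u, w, St.s2) ∈ after b e (Z i) k G := fun w =>
      mem_after (h u w) (hk w) (hgo u (hall u) w)
    by_cases hw : ∃ w, ev b e (!u) w (Z i) .s1 = k
    · obtain ⟨w, hw⟩ := hw
      exact ⟨k, .inr (bad_of_three_s2 hb he hu (mem_after (h _ w) hw (hgo _ (hall _) w)))⟩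
    obtain hy | hy := avoids_or_hasHead (e u) (Z !i)
    · exact ⟨k, .inr (bad_of_two_s2 hb (forall_avoids (hav u) hy) hu)⟩
    · refine ⟨!k, .inr (bad_of_two_s2 (u := !u) hb
        (forall_avoids (hav _) (.inr ⟨_, he u, hy⟩)) fun w =>
          mem_after (h _ w) ?_ (hgo _ (hall _) w))⟩
      exact Bool.eq_not.mpr fun h => hw ⟨w, h⟩
  push Not at hall
  obtain ⟨n, hn⟩ := hall
  by_cases hs : Stays b e (!n) (Z i)
  · have hst : ∀ u, Stays b e u (Z i) := by
      intro u
      cases u <;> cases n <;> assumption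
    choose k hk using hst
    have hmem : ∀ u w, (u, w, St.s1) ∈ after b e (Z i) (k u) G := fun u w =>
      mem_after (h u w) (hk u w).1 (hk u w).2
    by_cases hkk : k true = k false
    · refine ⟨k true, .inl fun v w => ?_⟩
      cases v
      · exact hkk ▸ hmem false w
      · exact hmem true w
    suffices hex : ∃ u, Stays b e u (Z !i) ∨ (∃ w, dr b e u w (Z !i) .s1 = dead w) ∨
        ((∀ j, Avoids (e u) (Z j)) ∧
          ∃ k, ∀ w, ev b e u w (Z !i) .s1 = k ∧ dr b e u w (Z !i) .s1 = .s2) by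
      obtain ⟨u, hu⟩ := hex
      refine ⟨k u, .inr (bad_of_two_s1 (u := u) ?_ hb (hmem u))⟩
      intro j
      have hj : j = i ∨ j = !i := by cases i <;> cases j <;> simp
      obtain rfl | rfl := hj
      · exact .inl ⟨_, hk u⟩
      · exact hu
    obtain hy | ⟨x, hy⟩ := (Z !i).isConst_or_hasHead
    · exact ⟨true, .inl (stays_of_isConst hy _)⟩
    by_cases hxb : x = b
    · subst hxb
      by_cases hdy : ∃ u, Stays x e u (Z !i) ∨ ∃ w, dr x e u w (Z !i) .s1 = dead w
      · obtain ⟨u, hu⟩ := hdy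
        exact ⟨u, hu.imp_right .inl⟩
      push Not at hdy
      have hgy : ∀ u w, dr x e u w (Z !i) .s1 = .s2 := fun u =>
        (exists_dead_or_eq_s2 (hdy u).1).resolve_left fun ⟨w, hw⟩ => (hdy u).2 w hw
      obtain ⟨u, m, hm⟩ := exists_unseparated hb hy hgy (hZ _)
      exact ⟨u, .inr (.inr ⟨forall_avoids (hav u) (.inr ⟨x, (hb u).symm, hy⟩),
        m, fun w => ⟨hm w, hgy u w⟩⟩)⟩
    · obtain ⟨u, hu⟩ := exists_ne_branch he x
      exact ⟨u, .inr (.inl ⟨true, dr_of_next_dead hb hy (next_s1 hxb hu)⟩)⟩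
  · obtain ⟨p, hp⟩ := hn
    have hmem : ∀ w, (n, w, St.s1) ∈ after b e (Z i) p G := fun w =>
      mem_after (h n w) (hp w).1 (hp w).2
    by_cases hw : ∃ w, ev b e (!n) w (Z i) .s1 = p
    · obtain ⟨w, hw⟩ := hw
      refine ⟨p, .inr (bad_of_s2_s1 (u := !n) (w := w) (w' := true) hb he
        (mem_after (h _ w) hw (hgo _ hs w)) ?_)⟩
      rw [Bool.not_not]
      exact hmem true
    obtain hy | hy := avoids_or_hasHead (e !n) (Z !i)
    · refine ⟨!p, .inr (bad_of_two_s2 (u := !n) hb (forall_avoids (hav _) hy) fun w =>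
        mem_after (h _ w) ?_ (hgo _ hs w))⟩
      exact Bool.eq_not.mpr fun h => hw ⟨w, h⟩
    · refine ⟨p, .inr (bad_of_two_s1 (u := n) ?_ hb hmem)⟩
      intro j
      have hj : j = i ∨ j = !i := by cases i <;> cases j <;> simp
      obtain rfl | rfl := hj
      · exact .inl ⟨p, hp⟩
      · exact .inr (.inl ⟨true, dr_of_next_dead hb hy (next_s1 (hb _) (he n).symm)⟩)

theorem bad_start (hb : ∀ u, e u ≠ b) (he : ∀ u, e u ≠ e !u)
    (hZ : ∀ i, ¬ Branches b e (Z i)) : Bad b e Z {g | g.2.2 = St.s0} := by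
  refine Bad.coinduct
    (fun G => (∀ v w, (v, w, St.s0) ∈ G) ∨ ∀ v w, (v, w, St.s1) ∈ G) ?_ ?_ ?_ (.inl fun _ _ => rfl)
  · rintro G (h | h) G' hG
    · exact .inl fun v w => hG (h v w)
    · exact .inr fun v w => hG (h v w)
  · rintro G (h | h) hW
    · exact (hW _ _ _ (h true true)).2 _ (h _ _)
    · exact (hW _ _ _ (h true true)).2 _ (h _ _)
  · intro G h i
    obtain ⟨k, hk⟩ | ⟨x, hx⟩ := (Z i).isConst_or_hasHead
    · exact ⟨k, .inl (h.imp (fun h v w => after_const hk (h v w))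
        fun h v w => after_const hk (h v w))⟩
    by_cases hxb : x = b
    · subst hxb
      obtain h | h := h
      · obtain ⟨k, hk⟩ := exists_after_s1 (G := {g | g.2.2 = St.s1}) hb he hZ
          (fun _ _ => rfl) i hx
        have hsub : after x e (Z i) k {g | g.2.2 = St.s1} ⊆ after x e (Z i) k G := by
          rintro ⟨v, w, s⟩ ⟨s', rfl, h2, h3⟩
          have := hasHead_s0 hb hx v w
          exact mem_after (h v w) (this.1.trans h2) (this.2.trans h3)
        exact ⟨k, hk.imp (fun hk => .inr fun v w => hsub (hk v w)) fun hk => hk.mono hsub⟩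
      · exact (exists_after_s1 hb he hZ h i hx).imp fun _ hk => hk.imp_left .inr
    · obtain h | h := h
      · exact (bad_after_of_dead (h true true)
          (dr_of_next_dead hb hx (by simp [next, hxb]))).imp fun _ => .inr
      · obtain ⟨u, hu⟩ := exists_ne_branch he x
        exact (bad_after_of_dead (h u true)
          (dr_of_next_dead hb hx (next_s1 hxb hu))).imp fun _ => .inr

theorem not_branches_substVar (hb : ∀ u, e u ≠ b) (he : ∀ u, e u ≠ e !u)
    (hZ : ∀ i, ¬ Branches b e (Z i)) (f : PS Bool) : ¬ Branches b e (f.substVar Z) := by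
  intro hf
  obtain ⟨k, hk⟩ := (bad_start hb he hZ).after_subst f
  refine hk.not_won ?_
  rintro v w s ⟨_, rfl, h1, h2⟩
  refine ⟨h2.symm.trans ((hf v).1 w), ?_⟩
  rintro s' ⟨_, rfl, h3, h4⟩
  refine (hf v).2 ?_
  cases w
  · exact h3.trans h1.symm
  · exact h1.trans h3.symm

end main

theorem T12.not_branches (hb : ∀ u, e u ≠ b) (he : ∀ u, e u ≠ e !u) {X : Type} {s : PS X}
    (hs : T12 s) (σ : X → PS A) (hσ : ∀ x, ¬ Branches b e (σ x)) :
    ¬ Branches b e (s.substVar σ) := by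
  induction hs generalizing σ with
  | tt => exact fun h => by simpa [PS.substVar, dr_tt] using (h true).1 true
  | ff => exact fun h => by simpa [PS.substVar, dr_ff] using (h true).1 true
  | one x t =>
    have := not_branches_substVar (Z := fun _ => σ x) hb he (fun _ => hσ x)
      (t.substVar fun _ => .atom true)
    rw [PS.substVar_substVar] at this ⊢
    exact this
  | two x y t =>
    rw [PS.substVar_substVar]
    refine not_branches_substVar hb he (fun i => ?_) t
    cases i
    · exact hσ y
    · exact hσ x
  | subst τ _ _ ih ihτ =>
    rw [PS.substVar_substVar]
    exact ih _ fun x => ihτ x σ hσ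

theorem not_branches_atom (x : A) : ¬ Branches b e (.atom x) := by
  intro h
  have := (h true).1 true
  simp only [dr_atom, next, dead] at this
  split at this <;> simp at this

theorem branches_of_kCong (hb : ∀ u, e u ≠ b) {t : PS A}
    (h : KCong crK t (.cond (.atom (e true)) (.atom b) (.atom (e false)))) :
    Branches b e t := by
  obtain ⟨R, ⟨hR, hc⟩, hK, ht⟩ := h
  have key : ∀ v w, ev b e v w t .s0 = w ∧ dr b e v w t .s0 = .s2 := by
    intro v w
    have hv : b ≠ e v := (hb v).symm
    have hv' := hb v
    have h0 := hK _ _ ht _ (crK_testVA hb v w) St.s0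
    have h1 := fun u => hK _ _ (hc (hR.refl u) ht (hR.refl u)) _ (crK_testVA hb v w) St.s0
    change ev b e v w _ _ = ev b e v w _ _ at h0
    change ∀ u, ev b e v w _ _ = ev b e v w _ _ at h1
    have hw : ev b e v w t .s0 = w := by
      rw [h0]
      cases v <;> simp [ev_cond, ev_atom, dr_atom, answer, next, hb]
    refine ⟨hw, ?_⟩
    have hu : ∀ u, ev b e v w u (dr b e v w t .s0) = ev b e v w u .s2 := by
      intro u
      have := h1 u
      rw [ev_cond, ite_self, ev_cond, ite_self] at this
      rw [this]
      cases v <;> simp [ev_atom, dr_cond, dr_atom, answer, next, hb]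
    have hu1 := hu (.atom (e v))
    have hu2 := hu (.cond (.atom (e v)) (.atom b) (.atom (e v)))
    clear h1 hu ht h0 hw
    generalize dr b e v w t .s0 = s at hu1 hu2 ⊢
    cases s <;> cases w <;>
      simp_all [ev_atom, ev_cond, dr_atom, answer, next, dead]
  exact fun v => ⟨fun w => (key v w).2, by simp [(key v _).1]⟩

end Incompleteness

/-- **Functional incompleteness of binary connectives modulo contractive
valuation congruence**: if `a, b, c` are pairwise distinct atoms then no term
of `T_C^{1,2}(A)` is contractive-valuation congruent to `a ◁ b ▷ c`. -/
theorem conditional_not_expressible_cr {A : Type} [Countable A]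
    (a b c : A) (hab : a ≠ b) (hac : a ≠ c) (hbc : b ≠ c) :
    ¬ ∃ t : PS A, TC12A t ∧
      KCong crK t (.cond (.atom a) (.atom b) (.atom c)) := by
  rintro ⟨t, ⟨s, f, hs, rfl⟩, ht⟩
  have hb : ∀ u, (fun u => if u then a else c : Bool → A) u ≠ b := by
    rintro (_ | _)
    · exact hbc.symm
    · exact hab
  have he : ∀ u, (fun u => if u then a else c : Bool → A) u ≠
      (fun u => if u then a else c : Bool → A) !u := by
    rintro (_ | _)
    · exact hac.symm
    · exact hac
  exact Incompleteness.T12.not_branches hb he hs _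
    (fun n => Incompleteness.not_branches_atom (f n)) (Incompleteness.branches_of_kCong hb ht)
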